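/- Let J be an ideal of O, and let f, g ∈ O be nonzero and relatively prime. Assume that dim O/(J + ⟨g⟩) and i(f,g) are finite. Then dim O/(⟨f⟩·J + ⟨g⟩) = dim O/(J + ⟨g⟩) + i(f,g). -/

import Mathlib

noncomputable section

/-- The ring `O = ℂ[[x,y]]` of formal power series in two variables over `ℂ`. -/
abbrev O2 : Type := MvPowerSeries (Fin 2) ℂ

/-- Two elements of `O` are relatively prime if no prime element divides both. -/
def RelPrime (f g : O2) : Prop := ∀ p : O2, Prime p → p ∣ f → ¬ p ∣ g

open MvPowerSeries in
/-- A power of a variable dividing the product of `φ` with a power of another variable divides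
`φ`. -/
theorem MvPowerSeries.X_pow_dvd_of_dvd_X_pow_mul {σ R : Type*} [CommSemiring R] {s t : σ}
    (hst : s ≠ t) {m n : ℕ} {φ : MvPowerSeries σ R}
    (h : (X s : MvPowerSeries σ R) ^ n ∣ X t ^ m * φ) : (X s : MvPowerSeries σ R) ^ n ∣ φ := by
  rw [X_pow_dvd_iff] at h ⊢
  intro e he
  have := h (Finsupp.single t m + e) (by simpa [Finsupp.single_eq_of_ne hst] using he)
  rwa [X_pow_eq, coeff_add_monomial_mul, one_mul] at this

open Polynomial in
/-- An ideal of finite codimension in a power series ring over a field contains a power of each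
variable. -/
theorem MvPowerSeries.exists_X_pow_mem_of_finite_quotient {σ k : Type*} [Field k]
    (I : Ideal (MvPowerSeries σ k)) [Module.Finite k (MvPowerSeries σ k ⧸ I)] (s : σ) :
    ∃ n : ℕ, (MvPowerSeries.X s : MvPowerSeries σ k) ^ n ∈ I := by
  obtain ⟨p, hp, hpI⟩ := Algebra.IsIntegral.isIntegral (R := k)
    (Ideal.Quotient.mk I (MvPowerSeries.X s))
  obtain ⟨q, hq, hdvd⟩ := p.exists_eq_pow_rootMultiplicity_mul_and_not_dvd hp.ne_zero 0
  refine ⟨p.rootMultiplicity 0, ?_⟩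
  rw [map_zero, sub_zero] at hq hdvd
  have hunit : IsUnit (Polynomial.aeval (MvPowerSeries.X s : MvPowerSeries σ k) q) := by
    rw [MvPowerSeries.isUnit_iff_constantCoeff, isUnit_iff_ne_zero]
    rw [Polynomial.X_dvd_iff] at hdvd
    convert hdvd
    rw [Polynomial.aeval_def, hom_eval₂, MvPowerSeries.constantCoeff_X, eval₂_at_zero]
    simp [MvPowerSeries.algebraMap_apply]
  have hmem : Polynomial.aeval (MvPowerSeries.X s : MvPowerSeries σ k) p ∈ I := by
    rw [← Ideal.Quotient.eq_zero_iff_mem]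
    rw [← Ideal.Quotient.mkₐ_eq_mk k, ← Polynomial.aeval_algHom_apply]
    exact hpI
  rw [hq, map_mul, map_pow, Polynomial.aeval_X] at hmem
  exact (Ideal.mul_unit_mem_iff_mem I hunit).mp hmem

/-- If `f` and `g` generate an ideal of finite codimension in a power series ring in at least two
variables, then `f` is not a zero divisor modulo `g`. -/
theorem MvPowerSeries.dvd_of_dvd_mul_of_finite_quotient {σ k : Type*} [Field k] [Nontrivial σ]
    {f g h : MvPowerSeries σ k}
    [Module.Finite k (MvPowerSeries σ k ⧸ Ideal.span {f, g})] (hdvd : g ∣ f * h) : g ∣ h := by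
  have key (s : σ) : ∃ n : ℕ, g ∣ (X s : MvPowerSeries σ k) ^ n * h := by
    obtain ⟨n, hn⟩ := exists_X_pow_mem_of_finite_quotient (Ideal.span {f, g}) s
    obtain ⟨a, b, hab⟩ := Ideal.mem_span_pair.mp hn
    refine ⟨n, ?_⟩
    rw [← hab, add_mul, mul_assoc, mul_right_comm]
    exact dvd_add (hdvd.mul_left a) (dvd_mul_left g _)
  obtain ⟨s, t, hst⟩ := exists_pair_ne σ
  obtain ⟨m, u, hu⟩ := key s
  obtain ⟨n, v, hv⟩ := key t
  have hX (r : σ) (i : ℕ) : (X r : MvPowerSeries σ k) ^ i ≠ 0 := by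
    classical
    refine pow_ne_zero i fun h => one_ne_zero (α := k) ?_
    simpa using congrArg (coeff (Finsupp.single r 1)) h
  rcases eq_or_ne g 0 with rfl | hg
  · rw [zero_mul, mul_eq_zero] at hu
    exact (hu.resolve_left (hX s m)).symm ▸ dvd_rfl
  have huv : (X t : MvPowerSeries σ k) ^ n * u = X s ^ m * v :=
    mul_left_cancel₀ hg (by linear_combination X s ^ m * hv - X t ^ n * hu)
  obtain ⟨w, rfl⟩ := X_pow_dvd_of_dvd_X_pow_mul hst (Dvd.intro v huv.symm)
  exact ⟨w, mul_left_cancel₀ (hX s m) (by linear_combination hu)⟩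

/-- Codimension formula for `f J + (g)` when `f` is not a zero divisor modulo `g`. -/
theorem Ideal.finrank_quotient_span_mul_add_span {k A : Type*} [Field k] [CommRing A] [Algebra k A]
    (J : Ideal A) {f g : A} (hfg : ∀ h, g ∣ f * h → g ∣ h)
    [Module.Finite k (A ⧸ (J + Ideal.span {g}))] [Module.Finite k (A ⧸ Ideal.span {f, g})] :
    Module.finrank k (A ⧸ (Ideal.span {f} * J + Ideal.span {g})) =
      Module.finrank k (A ⧸ (J + Ideal.span {g})) + Module.finrank k (A ⧸ Ideal.span {f, g}) := by
  set K := Ideal.span {f} * J + Ideal.span {g}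
  have mem_K {x : A} : x ∈ K ↔ ∃ j ∈ J, g ∣ x - f * j := by
    simp only [K, Ideal.add_eq_sup, Submodule.mem_sup, Ideal.mem_span_singleton_mul,
      Ideal.mem_span_singleton]
    constructor
    · rintro ⟨_, ⟨j, hj, rfl⟩, b, hb, rfl⟩
      exact ⟨j, hj, by simpa using hb⟩
    · rintro ⟨j, hj, hb⟩
      exact ⟨_, ⟨j, hj, rfl⟩, _, hb, by ring⟩
  have hker : Submodule.comap (LinearMap.mulLeft A f) K = J + Ideal.span {g} := by
    ext x
    rw [Submodule.mem_comap, LinearMap.mulLeft_apply, mem_K, Ideal.add_eq_sup, Submodule.mem_sup]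
    constructor
    · rintro ⟨j, hj, hx⟩
      rw [← mul_sub] at hx
      exact ⟨j, hj, x - j, Ideal.mem_span_singleton.mpr (hfg _ hx), by ring⟩
    · rintro ⟨j, hj, b, hb, rfl⟩
      refine ⟨j, hj, ?_⟩
      rw [← mul_sub, add_sub_cancel_left]
      exact (Ideal.mem_span_singleton.mp hb).mul_left f
  have hle : K ≤ Ideal.span {f, g} := by
    rw [Ideal.span_insert]
    exact sup_le_sup_right Ideal.mul_le_left _
  let φ : (A ⧸ (J + Ideal.span {g})) →ₗ[k] A ⧸ K :=
    (Submodule.mapQ _ K (LinearMap.mulLeft A f) hker.ge).restrictScalars k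
  let ψ : (A ⧸ K) →ₗ[k] A ⧸ Ideal.span {f, g} :=
    (Ideal.Quotient.factorₐ k hle).toLinearMap
  have hφ : Function.Injective φ := by
    rw [← LinearMap.ker_eq_bot, LinearMap.ker_eq_bot']
    intro x hx
    obtain ⟨x, rfl⟩ := Submodule.Quotient.mk_surjective _ x
    have hx' : f * x ∈ K := (Submodule.Quotient.mk_eq_zero K).mp hx
    exact (Submodule.Quotient.mk_eq_zero _).mpr (hker ▸ hx')
  have hψ : Function.Surjective ψ := Ideal.Quotient.factor_surjective hle
  have hexact : LinearMap.range φ = LinearMap.ker ψ := by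
    ext x
    obtain ⟨x, rfl⟩ := Ideal.Quotient.mk_surjective x
    rw [LinearMap.mem_ker, LinearMap.mem_range]
    constructor
    · rintro ⟨y, hy⟩
      obtain ⟨y, rfl⟩ := Submodule.Quotient.mk_surjective _ y
      rw [← hy]
      exact Ideal.Quotient.eq_zero_iff_mem.mpr
        (Ideal.mul_mem_right y _ (Ideal.subset_span (by simp)))
    · intro hx
      obtain ⟨a, b, hab⟩ := Ideal.mem_span_pair.mp (Ideal.Quotient.eq_zero_iff_mem.mp hx)
      refine ⟨Submodule.Quotient.mk a, Ideal.Quotient.eq.mpr (mem_K.mpr ⟨0, J.zero_mem, -b, ?_⟩)⟩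
      rw [← hab, LinearMap.mulLeft_apply]
      ring
  have hker_finrank : Module.finrank k (LinearMap.ker ψ) =
      Module.finrank k (A ⧸ (J + Ideal.span {g})) := by
    rw [← hexact, LinearMap.finrank_range_of_inj hφ]
  have : Module.Finite k (A ⧸ K) :=
    Module.Finite.of_exact (LinearMap.exact_iff.mpr hexact.symm) hψ
  rw [← hker_finrank, add_comm, ← LinearMap.finrank_range_add_finrank_ker ψ,
    LinearMap.range_eq_top.mpr hψ, finrank_top]

theorem stmt1 (J : Ideal O2) (f g : O2) (hf : f ≠ 0) (hg : g ≠ 0)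
    (hrp : RelPrime f g)
    (h1 : Module.Finite ℂ (O2 ⧸ (J + Ideal.span {g})))
    (h2 : Module.Finite ℂ (O2 ⧸ (Ideal.span {f, g}))) :
    Module.finrank ℂ (O2 ⧸ (Ideal.span {f} * J + Ideal.span {g}))
      = Module.finrank ℂ (O2 ⧸ (J + Ideal.span {g}))
        + Module.finrank ℂ (O2 ⧸ (Ideal.span {f, g})) := by
  exact J.finrank_quotient_span_mul_add_span fun _ =>
    MvPowerSeries.dvd_of_dvd_mul_of_finite_quotient
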